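/- Let X be a proper Busemann space and let φ : X → ℝ be a horofunction (based at some point of X). Let x₀, x₀' ∈ X and let c, c' : [0,∞) → X be rays with c(0) = x₀ and c'(0) = x₀' such that for every t > 0, φ(c(t)) = φ(x₀) − t and c(t) minimizes φ on the closed ball of radius t about x₀, and likewise φ(c'(t)) = φ(x₀') − t and c'(t) minimizes φ on the closed ball of radius t about x₀'. Then d(c(t), c'(t)) ≤ d(x₀, x₀') for all t ≥ 0; in particular the rays c and c' are asymptotic (their images lie at finite Hausdorff distance). -/

import Mathlib

open Filter

def IsGeodesicSeg {X : Type*} [MetricSpace X] (γ : ℝ → X) (x y : X) : Prop :=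
  γ 0 = x ∧ γ 1 = y ∧
    ∀ s ∈ Set.Icc (0 : ℝ) 1, ∀ t ∈ Set.Icc (0 : ℝ) 1,
      dist (γ s) (γ t) = |s - t| * dist x y

def IsBusemannSpace (X : Type*) [MetricSpace X] : Prop :=
  (∀ x y : X, ∃ γ : ℝ → X, IsGeodesicSeg γ x y) ∧
    ∀ (γ₁ γ₂ : ℝ → X) (x y₁ y₂ : X), IsGeodesicSeg γ₁ x y₁ → IsGeodesicSeg γ₂ x y₂ →
      ∀ t ∈ Set.Icc (0 : ℝ) 1, dist (γ₁ t) (γ₂ t) ≤ t * dist y₁ y₂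

def IsRay {X : Type*} [MetricSpace X] (c : ℝ → X) : Prop :=
  ∀ s t : ℝ, 0 ≤ s → 0 ≤ t → dist (c s) (c t) = |s - t|

def IsHorofunction {X : Type*} [MetricSpace X] (x₀ : X) (φ : X → ℝ) : Prop :=
  ∃ x : ℕ → X, Tendsto (fun k => dist x₀ (x k)) atTop atTop ∧
    ∀ y : X, Tendsto (fun k => dist y (x k) - dist x₀ (x k)) atTop (nhds (φ y))

/-- `m` is a metric midpoint of `x` and `y`. -/
def IsMetricMidpoint {X : Type*} [MetricSpace X] (m x y : X) : Prop :=
  dist x m = dist x y / 2 ∧ dist m y = dist x y / 2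

section Busemann

variable {X : Type*} [MetricSpace X]

theorem IsMetricMidpoint.symm {m x y : X} (h : IsMetricMidpoint m x y) :
    IsMetricMidpoint m y x := by
  obtain ⟨h₁, h₂⟩ := h
  rw [dist_comm x m, dist_comm x y] at h₁
  rw [dist_comm m y, dist_comm x y] at h₂
  exact ⟨h₂, h₁⟩

theorem IsMetricMidpoint.of_le {m x y : X} {r : ℝ} (h₁ : dist x m ≤ r / 2)
    (h₂ : dist m y ≤ r / 2) (h : r ≤ dist x y) : IsMetricMidpoint m x y := by
  have := dist_triangle x m y
  constructor <;> linarith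

theorem IsBusemannSpace.exists_midpoint (hX : IsBusemannSpace X) (x y : X) :
    ∃ m, IsMetricMidpoint m x y := by
  obtain ⟨γ, h0, h1, hγ⟩ := hX.1 x y
  refine ⟨γ (1 / 2), ?_, ?_⟩
  · have := hγ 0 (by norm_num) (1 / 2) (by norm_num)
    rw [h0] at this
    rw [this]
    norm_num
    ring
  · have := hγ (1 / 2) (by norm_num) 1 (by norm_num)
    rw [h1] at this
    rw [this]
    norm_num
    ring

/-- A midpoint lies on a geodesic, obtained by concatenating two half-geodesics. -/
theorem IsBusemannSpace.exists_geodesic_through_midpoint (hX : IsBusemannSpace X) {m x y : X}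
    (h : IsMetricMidpoint m x y) : ∃ γ : ℝ → X, IsGeodesicSeg γ x y ∧ γ (1 / 2) = m := by
  obtain ⟨hm₁, hm₂⟩ := h
  obtain ⟨α, hα0, hα1, hα⟩ := hX.1 x m
  obtain ⟨β, hβ0, hβ1, hβ⟩ := hX.1 m y
  rw [hm₁] at hα
  rw [hm₂] at hβ
  have cross : ∀ s t : ℝ, 0 ≤ s → s ≤ 1 / 2 → 1 / 2 < t → t ≤ 1 →
      dist (α (2 * s)) (β (2 * t - 1)) = (t - s) * dist x y := by
    intro s t hs0 hs ht ht1
    have hsI : 2 * s ∈ Set.Icc (0 : ℝ) 1 := ⟨by linarith, by linarith⟩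
    have htI : 2 * t - 1 ∈ Set.Icc (0 : ℝ) 1 := ⟨by linarith, by linarith⟩
    have e₁ := hα 0 (by norm_num) (2 * s) hsI
    have e₂ := hα (2 * s) hsI 1 (by norm_num)
    have e₃ := hβ 0 (by norm_num) (2 * t - 1) htI
    have e₄ := hβ (2 * t - 1) htI 1 (by norm_num)
    rw [hα0, abs_of_nonpos (by linarith)] at e₁
    rw [hα1, abs_of_nonpos (by linarith)] at e₂
    rw [hβ0, abs_of_nonpos (by linarith)] at e₃
    rw [hβ1, abs_of_nonpos (by linarith)] at e₄
    have t₁ := dist_triangle (α (2 * s)) m (β (2 * t - 1))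
    have t₂ := dist_triangle4 x (α (2 * s)) (β (2 * t - 1)) y
    apply le_antisymm <;> nlinarith
  refine ⟨fun t => if t ≤ 1 / 2 then α (2 * t) else β (2 * t - 1), ⟨?_, ?_, ?_⟩, ?_⟩
  · simp [hα0]
  · norm_num [hβ1]
  · rintro s ⟨hs0, hs1⟩ t ⟨ht0, ht1⟩
    by_cases hs : s ≤ 1 / 2 <;> by_cases ht : t ≤ 1 / 2
    · simp only [hs, ht, if_true]
      rw [hα _ ⟨by linarith, by linarith⟩ _ ⟨by linarith, by linarith⟩, ← mul_sub, abs_mul]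
      norm_num
      ring
    · simp only [hs, ht, if_true, if_false]
      push Not at ht
      rw [cross s t hs0 hs ht ht1, abs_of_nonpos (by linarith)]
      ring
    · simp only [hs, ht, if_true, if_false]
      push Not at hs
      rw [dist_comm, cross t s ht0 ht hs hs1, abs_of_nonneg (by linarith)]
    · simp only [hs, ht, if_false]
      push Not at hs ht
      rw [hβ _ ⟨by linarith, by linarith⟩ _ ⟨by linarith, by linarith⟩,
        show 2 * s - 1 - (2 * t - 1) = 2 * (s - t) by ring, abs_mul]
      norm_num
      ring
  · simp [hα1]

theorem IsBusemannSpace.dist_midpoint_le (hX : IsBusemannSpace X) {a b x y z : X}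
    (ha : IsMetricMidpoint a x y) (hb : IsMetricMidpoint b x z) :
    dist a b ≤ dist y z / 2 := by
  obtain ⟨α, hα, rfl⟩ := hX.exists_geodesic_through_midpoint ha
  obtain ⟨β, hβ, rfl⟩ := hX.exists_geodesic_through_midpoint hb
  have := hX.2 α β x y z hα hβ (1 / 2) (by norm_num)
  linarith

theorem IsBusemannSpace.midpoint_unique (hX : IsBusemannSpace X) {a b x y : X}
    (ha : IsMetricMidpoint a x y) (hb : IsMetricMidpoint b x y) : a = b := by
  have := hX.dist_midpoint_le ha hb
  rw [dist_self] at this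
  exact dist_le_zero.1 (by linarith)

theorem IsBusemannSpace.dist_midpoint_le_average (hX : IsBusemannSpace X) {m y y' : X}
    (hm : IsMetricMidpoint m y y') (z : X) : dist m z ≤ (dist y z + dist y' z) / 2 := by
  obtain ⟨q, hq⟩ := hX.exists_midpoint y z
  have h₁ := hX.dist_midpoint_le hm hq
  have h₂ := dist_triangle m q z
  rw [hq.2] at h₂
  linarith

/-- A point realizing the maximal decrease `r` of a `1`-Lipschitz midpoint-convex function
on the ball of radius `r` about `p` is unique. -/
theorem IsBusemannSpace.eq_of_maximal_decrease (hX : IsBusemannSpace X) {φ : X → ℝ}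
    (hLip : ∀ a b, φ a - φ b ≤ dist a b)
    (hconv : ∀ m y y', IsMetricMidpoint m y y' → φ m ≤ (φ y + φ y') / 2)
    {p y y' : X} {r : ℝ} (hy : dist p y ≤ r) (hy' : dist p y' ≤ r)
    (hφ : φ y ≤ φ p - r) (hφ' : φ y' ≤ φ p - r) : y = y' := by
  have key : ∀ n : ℕ, ∀ (p : X) (r : ℝ), dist p y ≤ r → dist p y' ≤ r →
      φ y ≤ φ p - r → φ y' ≤ φ p - r → dist y y' ≤ 2 * r * (1 / 2) ^ n := by
    intro n
    induction n with
    | zero =>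
      intro p r hy hy' _ _
      have := dist_triangle_left y y' p
      linarith
    | succ n ih =>
      intro p r hy hy' hφ hφ'
      obtain ⟨m, hm⟩ := hX.exists_midpoint y y'
      obtain ⟨a, ha⟩ := hX.exists_midpoint y p
      obtain ⟨a', ha'⟩ := hX.exists_midpoint y' p
      have hpm : r ≤ dist p m := by
        have := hconv m y y' hm
        have := hLip p m
        linarith
      have hpy := dist_comm y p
      have hpy' := dist_comm y' p
      have ha₁ : dist p a ≤ r / 2 := by rw [dist_comm, ha.2]; linarith
      have ha'₁ : dist p a' ≤ r / 2 := by rw [dist_comm, ha'.2]; linarith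
      have ha₂ : dist a m ≤ r / 2 := (hX.dist_midpoint_le ha hm).trans (by linarith)
      have ha'₂ : dist a' m ≤ r / 2 := (hX.dist_midpoint_le ha' hm.symm).trans (by linarith)
      obtain rfl : a = a' := hX.midpoint_unique
        (IsMetricMidpoint.of_le ha₁ ha₂ hpm) (IsMetricMidpoint.of_le ha'₁ ha'₂ hpm)
      have hpa := hLip p a
      have := ih a (r / 2) (by rw [dist_comm, ha.1]; linarith)
        (by rw [dist_comm, ha'.1]; linarith) (by linarith) (by linarith)
      rw [pow_succ]
      linarith
  have hlim : Tendsto (fun n : ℕ => 2 * r * (1 / 2 : ℝ) ^ n) atTop (nhds (2 * r * 0)) :=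
    (tendsto_pow_atTop_nhds_zero_of_lt_one (by norm_num) (by norm_num)).const_mul _
  rw [mul_zero] at hlim
  exact dist_le_zero.1 (ge_of_tendsto' hlim fun n => key n p r hy hy' hφ hφ')

/-- Moving two points `x`, `x'` the same distance `t` towards `z` does not increase
their distance. -/
theorem IsBusemannSpace.exists_move_toward (hX : IsBusemannSpace X) {x x' z : X} {t : ℝ}
    (ht : 0 < t) (h : t ≤ dist x z) (h' : t ≤ dist x' z) :
    ∃ p p' : X, (dist x p ≤ t ∧ dist p z ≤ dist x z - t) ∧
      (dist x' p' ≤ t ∧ dist p' z ≤ dist x' z - t) ∧ dist p p' ≤ dist x x' := by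
  have move : ∀ {w : X} {γ : ℝ → X}, t ≤ dist w z → IsGeodesicSeg γ z w →
      1 - t / dist w z ∈ Set.Icc (0 : ℝ) 1 ∧ dist w (γ (1 - t / dist w z)) ≤ t ∧
        dist (γ (1 - t / dist w z)) z ≤ dist w z - t := by
    rintro w γ hw ⟨h0, h1, hγ⟩
    have hL : 0 < dist w z := ht.trans_le hw
    have hq₀ : 0 ≤ t / dist w z := by positivity
    have hq₁ : t / dist w z ≤ 1 := (div_le_one hL).2 hw
    have hq : t / dist w z * dist w z = t := div_mul_cancel₀ _ hL.ne'
    have hI : 1 - t / dist w z ∈ Set.Icc (0 : ℝ) 1 := ⟨by linarith, by linarith⟩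
    have e₁ := hγ 1 (by norm_num) _ hI
    have e₂ := hγ _ hI 0 (by norm_num)
    rw [h1, dist_comm z w, abs_of_nonneg (by linarith)] at e₁
    rw [h0, dist_comm z w, abs_of_nonneg (by linarith)] at e₂
    exact ⟨hI, by linarith, by linarith⟩
  obtain ⟨γ, hγ⟩ := hX.1 z x
  obtain ⟨γ', hγ'⟩ := hX.1 z x'
  obtain ⟨hI, hm⟩ := move h hγ
  obtain ⟨hI', hm'⟩ := move h' hγ'
  refine ⟨_, _, hm, hm', ?_⟩
  have hL : 0 < dist x z := ht.trans_le h
  have hL' : 0 < dist x' z := ht.trans_le h'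
  have e₁ := hX.2 γ γ' z x x' hγ hγ' _ hI
  have e₂ := hγ'.2.2 _ hI _ hI'
  have e₃ := dist_triangle (γ (1 - t / dist x z)) (γ' (1 - t / dist x z))
    (γ' (1 - t / dist x' z))
  have e₄ : |1 - t / dist x z - (1 - t / dist x' z)| * dist z x' =
      t / dist x z * |dist x z - dist x' z| := by
    rw [dist_comm z x', show 1 - t / dist x z - (1 - t / dist x' z) =
      t / dist x z * (dist x z - dist x' z) / dist x' z by field_simp; ring,
      abs_div, abs_mul, abs_of_pos hL', abs_of_pos (div_pos ht hL)]
    field_simp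
  have e₅ : t / dist x z * |dist x z - dist x' z| ≤ t / dist x z * dist x x' :=
    mul_le_mul_of_nonneg_left (abs_dist_sub_le x x' z) (by positivity)
  linarith

variable {φ : X → ℝ} {b : X} {u : ℕ → X}

theorem horofunction_sub_le_dist
    (hu : ∀ y, Tendsto (fun k => dist y (u k) - dist b (u k)) atTop (nhds (φ y))) (x y : X) :
    φ x - φ y ≤ dist x y :=
  le_of_tendsto' ((hu x).sub (hu y)) fun k => by
    have := dist_triangle x y (u k)
    linarith

theorem IsBusemannSpace.horofunction_midpoint_le (hX : IsBusemannSpace X)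
    (hu : ∀ y, Tendsto (fun k => dist y (u k) - dist b (u k)) atTop (nhds (φ y)))
    {m y y' : X} (hm : IsMetricMidpoint m y y') : φ m ≤ (φ y + φ y') / 2 :=
  le_of_tendsto_of_tendsto' (hu m) (((hu y).add (hu y')).div_const 2) fun k => by
    have := hX.dist_midpoint_le_average hm (u k)
    linarith

/-- Points at distance `t` from `x` in the direction of the points `u k` defining a horofunction
converge to the point of maximal decrease of the horofunction on the ball of radius `t`. -/
theorem IsBusemannSpace.tendsto_maximal_decrease [ProperSpace X] (hX : IsBusemannSpace X)
    (hu : ∀ y, Tendsto (fun k => dist y (u k) - dist b (u k)) atTop (nhds (φ y)))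
    {x q : X} {t : ℝ} {p : ℕ → X} (hq : dist x q ≤ t) (hφq : φ q ≤ φ x - t)
    (hp : ∀ᶠ k in atTop, dist x (p k) ≤ t ∧ dist (p k) (u k) ≤ dist x (u k) - t) :
    Tendsto p atTop (nhds q) := by
  refine (isCompact_closedBall x t).tendsto_nhds_of_unique_mapClusterPt
    (hp.mono fun k hk => by simpa [dist_comm] using hk.1) fun z hz hcl => ?_
  refine hX.eq_of_maximal_decrease (horofunction_sub_le_dist hu)
    (fun _ _ _ => hX.horofunction_midpoint_le hu) (by simpa [dist_comm] using hz) hq ?_ hφq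
  refine le_of_forall_pos_le_add fun ε hε => ?_
  have hfreq : ∃ᶠ k in atTop, p k ∈ Metric.ball z ε :=
    hcl.frequently (Metric.ball_mem_nhds z hε)
  have := le_of_tendsto_of_frequently ((hu z).sub (hu x)) (b := ε - t)
    ((hfreq.and_eventually hp).mono fun k ⟨hk, _, hk'⟩ => by
      rw [Metric.mem_ball, dist_comm] at hk
      have := dist_triangle z (p k) (u k)
      linarith)
  linarith

end Busemann

/-- The two gradient-like rays of a horofunction issuing from two different base points
stay at distance at most `dist x₀ x₀'` from each other; in particular they are asymptotic
(their images lie at finite Hausdorff distance). -/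
theorem horofunction_rays_asymptotic {X : Type*} [MetricSpace X] [ProperSpace X]
    (hX : IsBusemannSpace X) (φ : X → ℝ) (hφ : ∃ x₁ : X, IsHorofunction x₁ φ)
    (x₀ x₀' : X) (c c' : ℝ → X) (hc : IsRay c) (hc' : IsRay c')
    (hc0 : c 0 = x₀) (hc'0 : c' 0 = x₀')
    (hmin : ∀ t : ℝ, 0 < t → φ (c t) = φ x₀ - t ∧
      ∀ y : X, dist x₀ y ≤ t → φ (c t) ≤ φ y)
    (hmin' : ∀ t : ℝ, 0 < t → φ (c' t) = φ x₀' - t ∧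
      ∀ y : X, dist x₀' y ≤ t → φ (c' t) ≤ φ y) :
    (∀ t : ℝ, 0 ≤ t → dist (c t) (c' t) ≤ dist x₀ x₀') ∧
      EMetric.hausdorffEdist (c '' Set.Ici 0) (c' '' Set.Ici 0) ≠ ⊤ := by
  obtain ⟨b, u, hb, hu⟩ := hφ
  have far : ∀ (x : X) (t : ℝ), ∀ᶠ k in atTop, t ≤ dist x (u k) := fun x t =>
    (hb.eventually_ge_atTop (t + dist b x)).mono fun k hk => by
      have := dist_triangle b x (u k)
      linarith
  have hdist : ∀ t : ℝ, 0 ≤ t → dist (c t) (c' t) ≤ dist x₀ x₀' := by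
    intro t ht
    rcases ht.eq_or_lt with rfl | ht
    · rw [hc0, hc'0]
    have hev : ∀ᶠ k in atTop, ∃ p : X × X,
        (dist x₀ p.1 ≤ t ∧ dist p.1 (u k) ≤ dist x₀ (u k) - t) ∧
        (dist x₀' p.2 ≤ t ∧ dist p.2 (u k) ≤ dist x₀' (u k) - t) ∧
        dist p.1 p.2 ≤ dist x₀ x₀' := by
      filter_upwards [far x₀ t, far x₀' t] with k hk hk'
      obtain ⟨p, p', h⟩ := hX.exists_move_toward ht hk hk'
      exact ⟨(p, p'), h⟩
    have : Nonempty (X × X) := ⟨(x₀, x₀')⟩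
    obtain ⟨p, hp⟩ := hev.choice
    have hct : dist x₀ (c t) ≤ t := by
      rw [← hc0, hc 0 t le_rfl ht.le, zero_sub, abs_neg, abs_of_pos ht]
    have hct' : dist x₀' (c' t) ≤ t := by
      rw [← hc'0, hc' 0 t le_rfl ht.le, zero_sub, abs_neg, abs_of_pos ht]
    have h₁ := hX.tendsto_maximal_decrease hu hct (hmin t ht).1.le (hp.mono fun _ h => h.1)
    have h₂ := hX.tendsto_maximal_decrease hu hct' (hmin' t ht).1.le
      (hp.mono fun _ h => h.2.1)
    exact le_of_tendsto (h₁.dist h₂) (hp.mono fun _ h => h.2.2)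
  refine ⟨hdist, ne_top_of_le_ne_top (ENNReal.ofReal_ne_top (r := dist x₀ x₀')) ?_⟩
  apply Metric.hausdorffEDist_le_of_mem_edist
  · rintro _ ⟨t, ht, rfl⟩
    exact ⟨c' t, ⟨t, ht, rfl⟩, by
      rw [edist_dist]; exact ENNReal.ofReal_le_ofReal (hdist t ht)⟩
  · rintro _ ⟨t, ht, rfl⟩
    exact ⟨c t, ⟨t, ht, rfl⟩, by
      rw [edist_comm, edist_dist]; exact ENNReal.ofReal_le_ofReal (hdist t ht)⟩
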